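/- arXiv:1705.10893 — 4 statements merged into one kernel-verified Lean document; each statement's English description precedes it below -/
import Mathlib

section
/- In the directed Chung-Lu model, for every integer r ≥ 1 the expected number of present closed walks of length r satisfies E[trace(A^r)] ≥ (a·b/S)^r. -/
open Finset

noncomputable section
open scoped Classical

/-- Probability of observing the edge configuration `ω` when the directed edge `(i,j)`
is present independently with probability `p i j`. -/
def configProb (N : ℕ) (p : Fin N → Fin N → ℝ) (ω : Fin N → Fin N → Bool) : ℝ :=
  ∏ i : Fin N, ∏ j : Fin N, if ω i j then p i j else 1 - p i j

/-- Expectation of the functional `f` of the random edge configuration. -/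
def expect (N : ℕ) (p : Fin N → Fin N → ℝ) (f : (Fin N → Fin N → Bool) → ℝ) : ℝ :=
  ∑ ω : Fin N → Fin N → Bool, configProb N p ω * f ω

/-- Number of present closed walks of length `r`: tuples `(i₁, …, i_r, i₁)` all of whose
`r` edges are present in `ω`.  This equals `trace(A^r)` for the adjacency matrix `A`. -/
def closedWalkCount (N r : ℕ) (ω : Fin N → Fin N → Bool) : ℕ :=
  (Finset.univ.filter (fun c : Fin r → Fin N =>
      ∀ k : Fin r, ω (c k) (c (finRotate r k)) = true)).card

/-- Summing a product of entrywise weights over all configurations factorises over the edges. -/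
theorem sum_config_prod_eq_prod_sum (N : ℕ) (g : Fin N → Fin N → Bool → ℝ) :
    ∑ ω : Fin N → Fin N → Bool, ∏ i, ∏ j, g i j (ω i j) = ∏ i, ∏ j, ∑ x, g i j x := by
  simp only [Finset.prod_univ_sum, Fintype.piFinset_univ]

/-- The probability that all edges of `E` are present is the product of their probabilities. -/
theorem expect_forall_mem_present (N : ℕ) (p : Fin N → Fin N → ℝ) (E : Finset (Fin N × Fin N)) :
    expect N p (fun ω => if ∀ e ∈ E, ω e.1 e.2 = true then 1 else 0) = ∏ e ∈ E, p e.1 e.2 := by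
  have key : ∀ ω : Fin N → Fin N → Bool,
      configProb N p ω * (if ∀ e ∈ E, ω e.1 e.2 = true then 1 else 0) =
        ∏ i, ∏ j, (if ω i j then p i j else 1 - p i j) *
          (if (i, j) ∈ E → ω i j = true then 1 else 0) := by
    intro ω
    simp only [Finset.prod_mul_distrib, configProb]
    congr 1
    simp only [Finset.prod_ite_zero, Finset.prod_const_one, Finset.mem_univ, forall_true_left,
      Prod.forall]
  simp only [_root_.expect, key]
  rw [sum_config_prod_eq_prod_sum N (fun i j x => (if x then p i j else 1 - p i j) *
    (if (i, j) ∈ E → x = true then 1 else 0))]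
  have factor : ∀ i j, (∑ x : Bool, (if x then p i j else 1 - p i j) *
      (if (i, j) ∈ E → x = true then (1 : ℝ) else 0)) = if (i, j) ∈ E then p i j else 1 := by
    intro i j
    by_cases h : (i, j) ∈ E <;> simp [h]
  simp only [factor]
  rw [← Fintype.prod_prod_type' (fun i j => if (i, j) ∈ E then p i j else 1)]
  simp [Finset.prod_ite_mem]

/-- Repeating factors from `[0, 1]` can only decrease a product. -/
theorem prod_comp_le_prod_image {ι κ : Type*} [DecidableEq κ] (s : Finset ι) (g : ι → κ) (f : κ → ℝ)
    (h0 : ∀ x, 0 ≤ f x) (h1 : ∀ x, f x ≤ 1) :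
    ∏ k ∈ s, f (g k) ≤ ∏ x ∈ s.image g, f x := by
  rw [Finset.prod_comp f g]
  refine Finset.prod_le_prod (fun x _ => pow_nonneg (h0 x) _) fun x hx => ?_
  obtain ⟨k, hk, rfl⟩ := Finset.mem_image.1 hx
  exact pow_le_of_le_one (h0 _) (h1 _)
    (Finset.card_ne_zero_of_mem (Finset.mem_filter.2 ⟨hk, rfl⟩))

/-- The expected number of closed walks is the sum over closed walks of the product of the
probabilities of their distinct edges. -/
theorem expect_closedWalkCount (N r : ℕ) (p : Fin N → Fin N → ℝ) :
    expect N p (fun ω => (closedWalkCount N r ω : ℝ)) =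
      ∑ c : Fin r → Fin N,
        ∏ e ∈ Finset.univ.image (fun k => (c k, c (finRotate r k))), p e.1 e.2 := by
  simp only [← expect_forall_mem_present, _root_.expect]
  rw [Finset.sum_comm]
  refine Finset.sum_congr rfl fun ω _ => ?_
  rw [← Finset.mul_sum]
  congr 1
  simp [closedWalkCount, Finset.sum_boole]

/-- The weights of the closed walks of length `r`, counted with edge multiplicity, sum to
`(a · b / S) ^ r`. -/
theorem sum_prod_closedWalk_weight (N r : ℕ) (a b : Fin N → ℝ) (S : ℝ) :
    ∑ c : Fin r → Fin N, ∏ k, b (c k) * a (c (finRotate r k)) / S =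
      ((∑ i, a i * b i) / S) ^ r := by
  have rotate : ∀ c : Fin r → Fin N, ∏ k, b (c k) * a (c (finRotate r k)) / S =
      ∏ k, a (c k) * b (c k) / S := by
    intro c
    simp only [Finset.prod_div_distrib, Finset.prod_mul_distrib]
    rw [Equiv.prod_comp (finRotate r) (fun k => a (c k)), mul_comm]
  simp only [rotate]
  rw [Finset.sum_div, Finset.sum_pow', Fintype.piFinset_univ]

/-- In the directed Chung-Lu model, `E[trace(A^r)] ≥ (a·b/S)^r` for every `r ≥ 1`. -/
theorem expected_trace_lower_bound
    (N : ℕ) (a b : Fin N → ℝ) (ha : ∀ i, 0 ≤ a i) (hb : ∀ i, 0 ≤ b i)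
    (S : ℝ) (hS : 0 < S) (hSa : ∑ i, a i = S) (hSb : ∑ i, b i = S)
    (hmax : ∀ i j, a i * b j ≤ S)
    (r : ℕ) (hr : 1 ≤ r) :
    ((∑ i, a i * b i) / S) ^ r ≤
      expect N (fun i j => b i * a j / S) (fun ω => (closedWalkCount N r ω : ℝ)) := by
  rw [expect_closedWalkCount, ← sum_prod_closedWalk_weight]
  refine Finset.sum_le_sum fun c _ => ?_
  exact prod_comp_le_prod_image Finset.univ (fun k => (c k, c (finRotate r k)))
    (fun e => b e.1 * a e.2 / S) (fun e => div_nonneg (mul_nonneg (hb _) (ha _)) hS.le)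
    (fun e => (div_le_one hS).2 (mul_comm (b e.1) (a e.2) ▸ hmax _ _))
end
end

section
/- In the directed Chung-Lu model, write trace(A^r) = ∑_z 1_z where z ranges over all tuples (i_1, …, i_r, i_1) and 1_z is the indicator that all r edges of the closed walk z are present. Suppose 2r < a·b/S. Then ∑_{y ≠ z} Cov(1_y, 1_z) ≤ E[trace(A^r)] · (a·b/S)^r · [ exp( (2rS/(a·b))²·p_max / (1 − 2rS/(a·b)) ) − 1 + (2rS/(a·b))^r ], and consequently Var(trace(A^r)) ≤ E[trace(A^r)] + E[trace(A^r)] · (a·b/S)^r · [ exp( (2rS/(a·b))²·p_max / (1 − 2rS/(a·b)) ) − 1 + (2rS/(a·b))^r ]. -/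
open Finset

noncomputable section
open scoped Classical

/-- Indicator (as a real number) of the closed walk `(c 0, c 1, …, c (r-1), c 0)` being present,
i.e. all of its `r` edges present in `ω`. -/
def cwInd (N r : ℕ) (c : Fin r → Fin N) (ω : Fin N → Fin N → Bool) : ℝ :=
  if ∀ k : Fin r, ω (c k) (c (finRotate r k)) = true then 1 else 0

/-- Covariance of two real functionals of the random edge configuration. -/
def covOf (N : ℕ) (p : Fin N → Fin N → ℝ) (f g : (Fin N → Fin N → Bool) → ℝ) : ℝ :=
  expect N p (fun ω => f ω * g ω) - expect N p f * expect N p g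

/-- Variance of a real functional of the random edge configuration. -/
def varOf (N : ℕ) (p : Fin N → Fin N → ℝ) (f : (Fin N → Fin N → Bool) → ℝ) : ℝ :=
  expect N p (fun ω => (f ω - expect N p f) ^ 2)

section TransferMatrix

variable {α R : Type*} [Fintype α] [DecidableEq α] [CommSemiring R]

lemma sum_prod_path_mul (M : Matrix α α R) (n : ℕ) (F : α → α → R) :
    ∑ g : Fin (n + 1) → α, (∏ k : Fin n, M (g k.castSucc) (g k.succ)) * F (g 0) (g (Fin.last n)) =
      ∑ i, ∑ j, (M ^ n) i j * F i j := by
  induction n generalizing F with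
  | zero =>
    rw [← (Equiv.funUnique (Fin 1) α).symm.sum_comp]
    simp [Matrix.one_apply]
  | succ n ih =>
    rw [← (Fin.snocEquiv (fun _ : Fin (n + 2) => α)).sum_comp, Fintype.sum_prod_type_right]
    have h := ih (fun i j => ∑ x, M j x * F i x)
    calc _ = ∑ g : Fin (n + 1) → α, (∏ k : Fin n, M (g k.castSucc) (g k.succ)) *
          ∑ x, M (g (Fin.last n)) x * F (g 0) x := by
          refine Finset.sum_congr rfl fun g _ => ?_
          rw [Finset.mul_sum]
          refine Finset.sum_congr rfl fun x _ => ?_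
          rw [Fin.prod_univ_castSucc]
          have h0 : Fin.snoc (α := fun _ => α) g x 0 = g 0 := by
            exact Fin.snoc_castSucc (α := fun _ => α) x g 0
          simp only [Fin.snocEquiv_apply, Fin.snoc_castSucc, ← Fin.castSucc_succ, Fin.succ_last,
            Fin.snoc_last, h0, mul_assoc]
      _ = _ := by
          rw [h]
          refine Finset.sum_congr rfl fun i _ => ?_
          simp only [pow_succ, Matrix.mul_apply, Finset.mul_sum, Finset.sum_mul]
          rw [Finset.sum_comm]
          simp only [mul_assoc]

/-- The trace of a matrix power is the total weight of the closed walks of that length. -/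
lemma sum_prod_cycle_eq_trace (M : Matrix α α R) (n : ℕ) :
    ∑ g : Fin (n + 1) → α, ∏ k, M (g k) (g (k + 1)) = (M ^ (n + 1)).trace := by
  have h := sum_prod_path_mul M n (fun i j => M j i)
  simp only [Matrix.trace, Matrix.diag_apply, pow_succ, Matrix.mul_apply]
  rw [← h]
  refine Finset.sum_congr rfl fun g _ => ?_
  rw [Fin.prod_univ_castSucc]
  simp [Fin.coeSucc_eq_succ]

end TransferMatrix

/-- Power sums of the roots of the characteristic polynomial of a `2 × 2` matrix. -/
lemma trace_pow_eq_of_bool {R : Type*} [CommRing R] (M : Matrix Bool Bool R) (u v : R)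
    (ht : M true true + M false false = u + v)
    (hd : M true true * M false false - M true false * M false true = u * v) (n : ℕ) :
    (M ^ n).trace = u ^ n + v ^ n := by
  have hsq : M ^ 2 = (u + v) • M - (u * v) • (1 : Matrix Bool Bool R) := by
    rw [← ht, ← hd]
    ext i j
    cases i <;> cases j <;> simp [pow_two, Matrix.mul_apply] <;> ring
  induction n using Nat.twoStepInduction with
  | zero => simp [Matrix.trace]; norm_num
  | one => simp [Matrix.trace, ht]
  | more n h0 h1 =>
    rw [pow_add, hsq, mul_sub, Matrix.mul_smul, Matrix.mul_smul, mul_one, ← pow_succ,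
      Matrix.trace_sub, Matrix.trace_smul, Matrix.trace_smul, h0, h1]
    simp only [smul_eq_mul]
    ring

lemma trace_pow_le_of_bool (M : Matrix Bool Bool ℝ) {l s w : ℝ} (hs : 0 ≤ s) (hsl : s < l)
    (hl : M true true = l) (hs' : M false false = s) (hw : M true false * M false true = s * w)
    (hw0 : 0 ≤ w) (hwl : w ≤ l) (n : ℕ) :
    (M ^ n).trace ≤ (l + s * w / (l - s)) ^ n + s ^ n := by
  have hls : 0 < l - s := sub_pos.2 hsl
  set D := Real.sqrt ((l - s) ^ 2 + 4 * (s * w)) with hD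
  have hsw : 0 ≤ s * w := mul_nonneg hs hw0
  have hDsq : D ^ 2 = (l - s) ^ 2 + 4 * (s * w) := Real.sq_sqrt (by positivity)
  have hD0 : 0 ≤ D := Real.sqrt_nonneg _
  have hDl : l - s ≤ D := Real.le_sqrt_of_sq_le (by linarith)
  have hDu : D ≤ l + s := by
    refine Real.sqrt_le_iff.2 ⟨by linarith, ?_⟩
    nlinarith [mul_le_mul_of_nonneg_left hwl hs]
  have hDd : D ≤ (l - s) + 2 * (s * w / (l - s)) := by
    have hd : 0 ≤ s * w / (l - s) := by positivity
    refine Real.sqrt_le_iff.2 ⟨by linarith, ?_⟩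
    have : (l - s) * (s * w / (l - s)) = s * w := by field_simp
    nlinarith
  rw [trace_pow_eq_of_bool M ((l + s + D) / 2) ((l + s - D) / 2) (by rw [hl, hs']; ring)
    (by rw [hl, hs', hw]; nlinarith)]
  gcongr <;> linarith

lemma sum_prod_le_prod_sum {ι κ X : Type*} [Fintype ι] [DecidableEq ι] [Fintype X]
    {s : Finset κ} {g : κ → ι → X} (hg : Set.InjOn g s) {f : ι → X → ℝ}
    (hf : ∀ i x, 0 ≤ f i x) : ∑ c ∈ s, ∏ i, f i (g c i) ≤ ∏ i, ∑ x, f i x := by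
  rw [Fintype.prod_sum, ← Finset.sum_image (f := fun h : ι → X => ∏ i, f i (h i)) hg]
  exact Finset.sum_le_sum_of_subset_of_nonneg (Finset.subset_univ _) fun h _ _ =>
    Finset.prod_nonneg fun i _ => hf i _

section ClosedWalk

variable {V : Type*} {n : ℕ}

/-- The `k`-th directed edge of the closed walk `c`. -/
def walkEdge (c : Fin (n + 1) → V) (k : Fin (n + 1)) : V × V := (c k, c (k + 1))

/-- The set of directed edges of the closed walk `c`. -/
def walkEdges [DecidableEq V] (c : Fin (n + 1) → V) : Finset (V × V) :=
  Finset.univ.image (walkEdge c)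

/-- The number of steps needed to go from position `t` to position `k` around the cycle. -/
def cycleDist (t k : Fin (n + 1)) : ℕ := (k - t).val

lemma cycleDist_injective (t : Fin (n + 1)) : Function.Injective (cycleDist t) := fun j k h => by
  simpa using Fin.ext h

lemma cycleDist_succ_le (t k : Fin (n + 1)) : cycleDist t (k + 1) ≤ cycleDist t k + 1 := by
  unfold cycleDist
  rw [add_sub_right_comm, Fin.val_add_one]
  split_ifs <;> omega

lemma cycleDist_pred {t k : Fin (n + 1)} (h : k ≠ t) :
    cycleDist t (k - 1) + 1 = cycleDist t k := by
  unfold cycleDist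
  have h1 := Fin.val_add_one (k - 1 - t)
  have h2 : k - 1 - t + 1 = k - t := by abel
  rw [h2] at h1
  split_ifs at h1 with h3
  · exact absurd (sub_eq_zero.1 (Fin.ext h1)) h
  · exact h1.symm

variable (Z : Finset (V × V))

/-- A position of `c` carrying an edge of `Z`, chosen through the set of all such positions. -/
def basePos (c : Fin (n + 1) → V) : Fin (n + 1) :=
  if h : ∃ k, k ∈ {k | walkEdge c k ∈ Z} then Classical.choose h else 0

lemma basePos_mem {c : Fin (n + 1) → V} (h : ∃ k, walkEdge c k ∈ Z) :
    walkEdge c (basePos Z c) ∈ Z := by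
  have h' : ∃ k, k ∈ {k | walkEdge c k ∈ Z} := h
  rw [basePos, dif_pos h']
  exact Classical.choose_spec h'

lemma basePos_congr {c d : Fin (n + 1) → V} (h : ∀ k, walkEdge c k ∈ Z ↔ walkEdge d k ∈ Z) :
    basePos Z c = basePos Z d := by
  have : {k | walkEdge c k ∈ Z} = {k | walkEdge d k ∈ Z} := Set.ext h
  simp only [basePos, this]

/-- The step of `c` at `k` is fresh if it uses an edge outside `Z` that was not used between the
base position and `k`. -/
def IsFresh (c : Fin (n + 1) → V) (k : Fin (n + 1)) : Prop :=
  walkEdge c k ∉ Z ∧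
    ∀ j, cycleDist (basePos Z c) j < cycleDist (basePos Z c) k → walkEdge c j ≠ walkEdge c k

/-- The fresh positions of `c`, as a Boolean pattern. -/
def freshPattern (c : Fin (n + 1) → V) (k : Fin (n + 1)) : Bool := decide (IsFresh Z c k)

lemma exists_repeat {c : Fin (n + 1) → V} {k : Fin (n + 1)} (h : ¬ IsFresh Z c k)
    (hZ : walkEdge c k ∉ Z) :
    ∃ j, cycleDist (basePos Z c) j < cycleDist (basePos Z c) k ∧ walkEdge c j = walkEdge c k := by
  by_contra! H
  exact h ⟨hZ, H⟩

/-- Local datum from which a closed walk is recovered: a vertex between two fresh steps, nothing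
at the beginning of a run of fresh steps, and at a step which is not fresh either its edge in `Z`
or a position at which its edge was used before. -/
def walkCode (c : Fin (n + 1) → V) (k : Fin (n + 1)) : Option (V ⊕ (V × V) ⊕ Fin (n + 1)) :=
  if h : IsFresh Z c k then
    if IsFresh Z c (k - 1) then some (.inl (c k)) else none
  else if hZ : walkEdge c k ∈ Z then some (.inr (.inl (walkEdge c k)))
  else some (.inr (.inr (Classical.choose (exists_repeat Z h hZ))))

lemma walkCode_eq_edge_iff {c : Fin (n + 1) → V} {k : Fin (n + 1)} :
    (∃ e, walkCode Z c k = some (.inr (.inl e))) ↔ walkEdge c k ∈ Z := by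
  unfold walkCode
  split_ifs with h1 h2 h3 <;> simp [*]
  · exact h1.1
  · exact h1.1

lemma walkCode_edge {c : Fin (n + 1) → V} {k : Fin (n + 1)} (h : walkEdge c k ∈ Z) :
    walkCode Z c k = some (.inr (.inl (walkEdge c k))) := by
  have h1 : ¬ IsFresh Z c k := fun h' => h'.1 h
  simp [walkCode, h1, h]

lemma walkCode_repeat {c : Fin (n + 1) → V} {k j : Fin (n + 1)}
    (h : walkCode Z c k = some (.inr (.inr j))) :
    cycleDist (basePos Z c) j < cycleDist (basePos Z c) k ∧ walkEdge c j = walkEdge c k := by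
  unfold walkCode at h
  split_ifs at h with h1 h2 h3
  · simp at h
  · simp at h
  · simp only [Option.some.injEq, Sum.inr.injEq] at h
    exact h ▸ Classical.choose_spec (exists_repeat Z h1 h3)

lemma exists_walkCode_repeat {c : Fin (n + 1) → V} {k : Fin (n + 1)} (h : ¬ IsFresh Z c k)
    (hZ : walkEdge c k ∉ Z) : ∃ j, walkCode Z c k = some (.inr (.inr j)) := by
  simp [walkCode, h, hZ]

lemma walkCode_injOn {c d : Fin (n + 1) → V} (hc : ∃ k, walkEdge c k ∈ Z)
    (hpat : freshPattern Z c = freshPattern Z d) (hcode : walkCode Z c = walkCode Z d) :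
    c = d := by
  have hmem : ∀ k, walkEdge c k ∈ Z ↔ walkEdge d k ∈ Z := fun k => by
    rw [← walkCode_eq_edge_iff, ← walkCode_eq_edge_iff, hcode]
  have hfresh : ∀ k, IsFresh Z c k ↔ IsFresh Z d k := fun k => by
    simpa [freshPattern] using congrFun hpat k
  have hbase := basePos_congr Z hmem
  have hedge : ∀ k, walkEdge c k ∈ Z → walkEdge c k = walkEdge d k := fun k hk => by
    have := congrFun hcode k
    rw [walkCode_edge Z hk, walkCode_edge Z ((hmem k).1 hk)] at this
    simpa using this
  set t := basePos Z c with ht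
  have hrep : ∀ k, ¬ IsFresh Z c k → walkEdge c k ∉ Z →
      ∃ j, cycleDist t j < cycleDist t k ∧ walkEdge c j = walkEdge c k ∧
        walkEdge d j = walkEdge d k := fun k h1 h2 => by
    obtain ⟨j, hj⟩ := exists_walkCode_repeat Z h1 h2
    have hj' := walkCode_repeat Z hj
    rw [hcode] at hj
    exact ⟨j, hj'.1, hj'.2, (walkCode_repeat Z hj).2⟩
  suffices H : ∀ m k, cycleDist t k = m → c k = d k from funext fun k => H _ k rfl
  intro m
  induction m using Nat.strong_induction_on with
  | _ m ih =>
    rintro k rfl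
    have key : ∀ j, cycleDist t j < cycleDist t k → c j = d j := fun j hj => ih _ hj j rfl
    by_cases hZ : walkEdge c k ∈ Z
    · exact congrArg Prod.fst (hedge k hZ)
    by_cases hk : IsFresh Z c k
    · have hkt : k ≠ t := fun h => hZ (h ▸ basePos_mem Z hc)
      have hdist := cycleDist_pred hkt
      by_cases hk1 : IsFresh Z c (k - 1)
      · have := congrFun hcode k
        simpa [walkCode, hk, hk1, (hfresh _).1 hk, (hfresh _).1 hk1] using this
      · by_cases hZ1 : walkEdge c (k - 1) ∈ Z
        · simpa [walkEdge] using congrArg Prod.snd (hedge _ hZ1)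
        · obtain ⟨j, hj, h1, h2⟩ := hrep _ hk1 hZ1
          have e1 : c (j + 1) = c k := by simpa [walkEdge] using congrArg Prod.snd h1
          have e2 : d (j + 1) = d k := by simpa [walkEdge] using congrArg Prod.snd h2
          rw [← e1, ← e2]
          exact key _ (by have := cycleDist_succ_le t j; omega)
    · obtain ⟨j, hj, h1, h2⟩ := hrep _ hk hZ
      have e1 : c j = c k := congrArg Prod.fst h1
      have e2 : d j = d k := congrArg Prod.fst h2
      rw [← e1, ← e2]
      exact key _ hj

lemma prod_sdiff_walkEdges [DecidableEq V] {R : Type*} [CommMonoid R] (c : Fin (n + 1) → V)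
    (f : V × V → R) :
    ∏ e ∈ walkEdges c \ Z, f e =
      ∏ k, if freshPattern Z c k then f (walkEdge c k) else 1 := by
  rw [← Finset.prod_filter]
  have himg : walkEdges c \ Z =
      (Finset.univ.filter fun k => freshPattern Z c k = true).image (walkEdge c) := by
    ext e
    simp only [walkEdges, Finset.mem_sdiff, Finset.mem_image, Finset.mem_univ, true_and,
      Finset.mem_filter, freshPattern, decide_eq_true_eq]
    constructor
    · rintro ⟨⟨k, rfl⟩, hZ⟩
      obtain ⟨j, hj, hmin⟩ := Finset.exists_min_image
        (Finset.univ.filter fun j => walkEdge c j = walkEdge c k) (cycleDist (basePos Z c))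
        ⟨k, by simp⟩
      simp only [Finset.mem_filter, Finset.mem_univ, true_and] at hj hmin
      refine ⟨j, ⟨by rwa [hj], fun i hi h => ?_⟩, hj⟩
      exact absurd (hmin i (h.trans hj)) (not_le.2 hi)
    · rintro ⟨k, hk, rfl⟩
      exact ⟨⟨k, rfl⟩, hk.1⟩
  rw [himg, Finset.prod_image]
  intro j hj k hk h
  simp only [Finset.coe_filter, Finset.mem_univ, true_and, Set.mem_ofPred_eq, freshPattern,
    decide_eq_true_eq] at hj hk
  refine cycleDist_injective (basePos Z c) (le_antisymm ?_ ?_)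
  · exact not_lt.1 fun hlt => hj.2 k hlt h.symm
  · exact not_lt.1 fun hlt => hk.2 j hlt h

end ClosedWalk

section Weights

variable {V : Type*} {n : ℕ} (Z : Finset (V × V)) (a b : V → ℝ) (S A B : ℝ)

/-- Weight of a local datum of a closed walk; the Booleans tell whether the incoming and the
outgoing step are fresh. -/
def codeWeight : Bool → Bool → Option (V ⊕ (V × V) ⊕ Fin (n + 1)) → ℝ
  | true, true, some (.inl v) => a v * b v / S
  | false, true, none => B / S
  | p, false, some (.inr (.inl e)) => if e ∈ Z then (if p then A else 1) else 0
  | p, false, some (.inr (.inr _)) => if p then A else 1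
  | _, _, _ => 0

/-- Transfer matrix of the patterns of fresh steps. -/
def freshMatrix [Fintype V] (r : ℝ) : Matrix Bool Bool ℝ
  | true, true => (∑ i, a i * b i) / S
  | false, true => B / S
  | true, false => 2 * r * A
  | false, false => 2 * r

variable {a b S A B}

lemma codeWeight_nonneg (ha : ∀ i, 0 ≤ a i) (hb : ∀ i, 0 ≤ b i) (hS : 0 ≤ S) (hA : 0 ≤ A)
    (hB : 0 ≤ B) (p q : Bool) (x : Option (V ⊕ (V × V) ⊕ Fin (n + 1))) :
    0 ≤ codeWeight Z a b S A B p q x := by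
  unfold codeWeight
  split <;> try split_ifs
  all_goals first | positivity | exact div_nonneg (mul_nonneg (ha _) (hb _)) hS

lemma sum_codeWeight_le [Fintype V] (hA : 0 ≤ A) (hZ : Z.card ≤ n + 1) (p q : Bool) :
    ∑ x : Option (V ⊕ (V × V) ⊕ Fin (n + 1)), codeWeight Z a b S A B p q x ≤
      freshMatrix a b S A B ((n + 1 : ℕ) : ℝ) p q := by
  have hZ' : (Z.card : ℝ) ≤ ((n + 1 : ℕ) : ℝ) := by exact_mod_cast hZ
  rw [Fintype.sum_option, Fintype.sum_sum_type, Fintype.sum_sum_type]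
  cases p <;> cases q <;> simp [codeWeight, freshMatrix, Finset.sum_div]
  · push_cast at hZ'; linarith
  · push_cast at hZ'; nlinarith

lemma prod_sdiff_walkEdges_le [DecidableEq V] (ha : ∀ i, 0 ≤ a i) (hb : ∀ i, 0 ≤ b i) (hS : 0 < S)
    (hA : ∀ i, a i ≤ A) (hB : ∀ i, b i ≤ B) (c : Fin (n + 1) → V) :
    ∏ e ∈ walkEdges c \ Z, b e.1 * a e.2 / S ≤
      ∏ k, codeWeight Z a b S A B (freshPattern Z c (k - 1)) (freshPattern Z c k)
        (walkCode Z c k) := by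
  have h1 : ∏ e ∈ walkEdges c \ Z, b e.1 * a e.2 / S =
      ∏ k, (if freshPattern Z c (k - 1) then a (c k) else 1) *
        (if freshPattern Z c k then b (c k) / S else 1) := by
    rw [prod_sdiff_walkEdges, Finset.prod_mul_distrib,
      ← Equiv.prod_comp (Equiv.addRight (1 : Fin (n + 1)))
        (fun k => if freshPattern Z c (k - 1) then a (c k) else 1), ← Finset.prod_mul_distrib]
    refine Finset.prod_congr rfl fun k _ => ?_
    simp only [Equiv.coe_addRight, add_sub_cancel_right, walkEdge]
    split_ifs <;> ring
  rw [h1]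
  refine Finset.prod_le_prod (fun k _ => ?_) fun k _ => ?_
  · have := ha (c k); have := hb (c k)
    split_ifs <;> positivity
  · unfold walkCode
    by_cases hk : IsFresh Z c k <;> by_cases hk1 : IsFresh Z c (k - 1)
    · simp [freshPattern, hk, hk1, codeWeight, mul_div_assoc]
    · simp [freshPattern, hk, hk1, codeWeight]
      gcongr
      exact hB _
    · by_cases hZ : walkEdge c k ∈ Z <;> simp [freshPattern, hk, hk1, hZ, codeWeight, hA]
    · by_cases hZ : walkEdge c k ∈ Z <;> simp [freshPattern, hk, hk1, hZ, codeWeight]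

/-- Closed walks through `Z`, weighted by their edges outside `Z`, are dominated by the cyclic
patterns that are not everywhere fresh. -/
lemma sum_prod_sdiff_walkEdges_le [Fintype V] [DecidableEq V] [Nonempty V]
    (ha : ∀ i, 0 ≤ a i) (hb : ∀ i, 0 ≤ b i) (hS : 0 < S) (hA : ∀ i, a i ≤ A) (hB : ∀ i, b i ≤ B)
    (hZ : Z.card ≤ n + 1) :
    ∑ c : Fin (n + 1) → V with ∃ k, walkEdge c k ∈ Z,
        ∏ e ∈ walkEdges c \ Z, b e.1 * a e.2 / S ≤
      (freshMatrix a b S A B ((n + 1 : ℕ) : ℝ) ^ (n + 1)).trace -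
        ((∑ i, a i * b i) / S) ^ (n + 1) := by
  obtain ⟨v⟩ := ‹Nonempty V›
  have hA0 : 0 ≤ A := (ha v).trans (hA v)
  have hB0 : 0 ≤ B := (hb v).trans (hB v)
  set M := freshMatrix a b S A B ((n + 1 : ℕ) : ℝ) with hM
  have htr : (M ^ (n + 1)).trace =
      ∑ g : Fin (n + 1) → Bool, ∏ k, M (g (k - 1)) (g k) := by
    rw [← sum_prod_cycle_eq_trace]
    refine Finset.sum_congr rfl fun g _ => ?_
    rw [← Equiv.prod_comp (Equiv.addRight (1 : Fin (n + 1))) fun k => M (g (k - 1)) (g k)]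
    simp
  rw [htr, ← Finset.sum_erase_add _ _ (Finset.mem_univ (fun _ : Fin (n + 1) => true))]
  have hone : ∏ k : Fin (n + 1), M true true = ((∑ i, a i * b i) / S) ^ (n + 1) := by
    simp [hM, freshMatrix, div_pow]
  rw [hone, add_sub_cancel_right]
  rw [← Finset.sum_fiberwise_of_maps_to
    (t := Finset.univ.erase (fun _ : Fin (n + 1) => true)) (g := freshPattern Z)]
  · refine Finset.sum_le_sum fun g _ => ?_
    calc _ ≤ ∑ c ∈ Finset.univ.filter (fun c : Fin (n + 1) → V => ∃ k, walkEdge c k ∈ Z) with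
            freshPattern Z c = g,
            ∏ k, codeWeight Z a b S A B (g (k - 1)) (g k) (walkCode Z c k) := by
          refine Finset.sum_le_sum fun c hc => ?_
          rw [← (Finset.mem_filter.1 hc).2]
          exact prod_sdiff_walkEdges_le Z ha hb hS hA hB c
      _ ≤ ∏ k, ∑ x, codeWeight Z a b S A B (g (k - 1)) (g k) x := by
          refine sum_prod_le_prod_sum (fun c hc d hd h => ?_)
            fun k x => codeWeight_nonneg Z ha hb hS.le hA0 hB0 _ _ _
          simp only [Finset.coe_filter, Finset.mem_filter, Finset.mem_univ, true_and,
            Set.mem_ofPred_eq] at hc hd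
          exact walkCode_injOn Z hc.1 (hc.2.trans hd.2.symm) h
      _ ≤ ∏ k, M (g (k - 1)) (g k) :=
          Finset.prod_le_prod
            (fun k _ => Finset.sum_nonneg fun x _ => codeWeight_nonneg Z ha hb hS.le hA0 hB0 _ _ _)
            fun k _ => sum_codeWeight_le Z hA0 hZ _ _
  · intro c hc
    obtain ⟨k, hk⟩ := (Finset.mem_filter.1 hc).2
    refine Finset.mem_erase.2 ⟨fun h => ?_, Finset.mem_univ _⟩
    have := congrFun h k
    simp only [freshPattern, decide_eq_true_eq] at this
    exact this.1 hk

end Weights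

section Expectation

variable {N : ℕ} (p : Fin N → Fin N → ℝ)

lemma expect_all_present (E : Finset (Fin N × Fin N)) :
    expect N p (fun ω => if ∀ e ∈ E, ω e.1 e.2 = true then 1 else 0) = ∏ e ∈ E, p e.1 e.2 := by
  set F : Fin N → Fin N → Bool → ℝ := fun i j x =>
    if x then p i j else if (i, j) ∈ E then 0 else 1 - p i j with hF
  have h1 : ∀ ω : Fin N → Fin N → Bool,
      configProb N p ω * (if ∀ e ∈ E, ω e.1 e.2 = true then 1 else 0) =
        ∏ i, ∏ j, F i j (ω i j) := fun ω => by
    split_ifs with h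
    · rw [mul_one, configProb]
      refine Finset.prod_congr rfl fun i _ => Finset.prod_congr rfl fun j _ => ?_
      by_cases hω : ω i j = true
      · simp [hF, hω]
      · have : (i, j) ∉ E := fun hij => hω (h _ hij)
        simp [hF, hω, this]
    · push Not at h
      obtain ⟨e, he, hω⟩ := h
      rw [mul_zero]
      refine (Finset.prod_eq_zero (Finset.mem_univ e.1)
        (Finset.prod_eq_zero (Finset.mem_univ e.2) ?_)).symm
      simp [hF, hω, he]
  calc _ = ∑ ω : Fin N → Fin N → Bool, ∏ i, ∏ j, F i j (ω i j) :=
        Finset.sum_congr rfl fun ω _ => h1 ω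
    _ = ∏ i, ∏ j, ∑ x, F i j x := by
        rw [← Fintype.prod_sum fun i (x : Fin N → Bool) => ∏ j, F i j (x j)]
        exact Finset.prod_congr rfl fun i _ => (Fintype.prod_sum fun j x => F i j x).symm
    _ = ∏ i, ∏ j, if (i, j) ∈ E then p i j else 1 := by
        refine Finset.prod_congr rfl fun i _ => Finset.prod_congr rfl fun j _ => ?_
        by_cases h : (i, j) ∈ E <;> simp [hF, h]
    _ = ∏ e ∈ E, p e.1 e.2 := by
        rw [← Fintype.prod_prod_type' (f := fun i j => if (i, j) ∈ E then p i j else 1),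
          Finset.prod_ite_mem, Finset.univ_inter]

lemma expect_sum {ι : Type*} (s : Finset ι) (f : ι → (Fin N → Fin N → Bool) → ℝ) :
    expect N p (fun ω => ∑ i ∈ s, f i ω) = ∑ i ∈ s, expect N p (f i) := by
  simp only [_root_.expect, Finset.mul_sum]
  exact Finset.sum_comm

lemma varOf_eq (f : (Fin N → Fin N → Bool) → ℝ) : varOf N p f = covOf N p f f := by
  have h1 : ∑ ω, configProb N p ω = 1 := by simpa [_root_.expect] using expect_all_present p ∅
  simp only [varOf, covOf]
  generalize hm : expect N p f = m
  have h2 : ∀ ω, configProb N p ω * (f ω - m) ^ 2 = configProb N p ω * (f ω * f ω) -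
      2 * m * (configProb N p ω * f ω) + m ^ 2 * configProb N p ω := fun ω => by ring
  simp only [_root_.expect] at hm ⊢
  simp only [h2, Finset.sum_add_distrib, Finset.sum_sub_distrib, ← Finset.mul_sum, h1, hm]
  ring

lemma covOf_sum_sum {ι κ : Type*} (s : Finset ι) (t : Finset κ)
    (f : ι → (Fin N → Fin N → Bool) → ℝ) (g : κ → (Fin N → Fin N → Bool) → ℝ) :
    covOf N p (fun ω => ∑ i ∈ s, f i ω) (fun ω => ∑ j ∈ t, g j ω) =
      ∑ i ∈ s, ∑ j ∈ t, covOf N p (f i) (g j) := by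
  simp only [covOf, Finset.sum_mul_sum, expect_sum, Finset.sum_sub_distrib]

variable {n : ℕ}

lemma cwInd_succ (c : Fin (n + 1) → Fin N) (ω : Fin N → Fin N → Bool) :
    cwInd N (n + 1) c ω = if ∀ e ∈ walkEdges c, ω e.1 e.2 = true then 1 else 0 := by
  simp [cwInd, walkEdges, walkEdge]

lemma closedWalkCount_eq_sum (r : ℕ) (ω : Fin N → Fin N → Bool) :
    (closedWalkCount N r ω : ℝ) = ∑ c, cwInd N r c ω := by
  simp [closedWalkCount, cwInd]

lemma expect_cwInd (c : Fin (n + 1) → Fin N) :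
    expect N p (cwInd N (n + 1) c) = ∏ e ∈ walkEdges c, p e.1 e.2 := by
  rw [← expect_all_present]
  exact congrArg _ (funext fun ω => cwInd_succ c ω)

lemma expect_cwInd_mul (c d : Fin (n + 1) → Fin N) :
    expect N p (fun ω => cwInd N (n + 1) c ω * cwInd N (n + 1) d ω) =
      (∏ e ∈ walkEdges d, p e.1 e.2) * ∏ e ∈ walkEdges c \ walkEdges d, p e.1 e.2 := by
  rw [← Finset.prod_union Finset.disjoint_sdiff, ← expect_all_present]
  refine congrArg _ (funext fun ω => ?_)
  rw [cwInd_succ, cwInd_succ, Finset.union_sdiff_self_eq_union]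
  simp only [Finset.mem_union, or_imp, forall_and, mul_ite, mul_one, mul_zero, ← ite_and]

variable {p}

lemma covOf_cwInd_le (hp : ∀ i j, 0 ≤ p i j) (c d : Fin (n + 1) → Fin N) :
    covOf N p (cwInd N (n + 1) c) (cwInd N (n + 1) d) ≤
      if ∃ k, walkEdge c k ∈ walkEdges d then
        expect N p (cwInd N (n + 1) d) * ∏ e ∈ walkEdges c \ walkEdges d, p e.1 e.2 else 0 := by
  have hnonneg : ∀ E : Finset (Fin N × Fin N), 0 ≤ ∏ e ∈ E, p e.1 e.2 := fun E =>
    Finset.prod_nonneg fun e _ => hp _ _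
  rw [covOf, expect_cwInd_mul, expect_cwInd, expect_cwInd]
  split_ifs with h
  · linarith [mul_nonneg (hnonneg (walkEdges c)) (hnonneg (walkEdges d))]
  · have hdisj : walkEdges c \ walkEdges d = walkEdges c := by
      refine Finset.sdiff_eq_self_of_disjoint (Finset.disjoint_left.2 fun e he => ?_)
      obtain ⟨k, -, rfl⟩ := Finset.mem_image.1 he
      exact fun hk => h ⟨k, hk⟩
    rw [hdisj, mul_comm, sub_self]

lemma covOf_cwInd_self_le (hp : ∀ i j, 0 ≤ p i j) (c : Fin (n + 1) → Fin N) :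
    covOf N p (cwInd N (n + 1) c) (cwInd N (n + 1) c) ≤ expect N p (cwInd N (n + 1) c) := by
  simpa [walkEdges] using covOf_cwInd_le hp c c

lemma sum_covOf_offDiag_le (hp : ∀ i j, 0 ≤ p i j) {K : ℝ}
    (hK : ∀ d : Fin (n + 1) → Fin N, ∑ c : Fin (n + 1) → Fin N with
      ∃ k, walkEdge c k ∈ walkEdges d, ∏ e ∈ walkEdges c \ walkEdges d, p e.1 e.2 ≤ K) :
    ∑ q ∈ (Finset.univ : Finset (Fin (n + 1) → Fin N)).offDiag,
        covOf N p (cwInd N (n + 1) q.1) (cwInd N (n + 1) q.2) ≤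
      expect N p (fun ω => (closedWalkCount N (n + 1) ω : ℝ)) * K := by
  have hnonneg : ∀ E : Finset (Fin N × Fin N), 0 ≤ ∏ e ∈ E, p e.1 e.2 := fun E =>
    Finset.prod_nonneg fun e _ => hp _ _
  have hexp : ∀ d : Fin (n + 1) → Fin N, 0 ≤ expect N p (cwInd N (n + 1) d) := fun d => by
    rw [expect_cwInd]; exact hnonneg _
  calc _ ≤ ∑ q ∈ (Finset.univ : Finset (Fin (n + 1) → Fin N)).offDiag,
          if ∃ k, walkEdge q.1 k ∈ walkEdges q.2 then expect N p (cwInd N (n + 1) q.2) *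
            ∏ e ∈ walkEdges q.1 \ walkEdges q.2, p e.1 e.2 else 0 :=
        Finset.sum_le_sum fun q _ => covOf_cwInd_le hp q.1 q.2
    _ ≤ ∑ q : (Fin (n + 1) → Fin N) × (Fin (n + 1) → Fin N),
          if ∃ k, walkEdge q.1 k ∈ walkEdges q.2 then expect N p (cwInd N (n + 1) q.2) *
            ∏ e ∈ walkEdges q.1 \ walkEdges q.2, p e.1 e.2 else 0 := by
        refine Finset.sum_le_sum_of_subset_of_nonneg (Finset.subset_univ _) fun q _ _ => ?_
        split_ifs
        exacts [mul_nonneg (hexp _) (hnonneg _), le_rfl]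
    _ = ∑ d, expect N p (cwInd N (n + 1) d) * ∑ c : Fin (n + 1) → Fin N with
          ∃ k, walkEdge c k ∈ walkEdges d, ∏ e ∈ walkEdges c \ walkEdges d, p e.1 e.2 := by
        rw [Fintype.sum_prod_type_right]
        refine Finset.sum_congr rfl fun d _ => ?_
        rw [Finset.mul_sum, Finset.sum_filter]
    _ ≤ ∑ d, expect N p (cwInd N (n + 1) d) * K :=
        Finset.sum_le_sum fun d _ => mul_le_mul_of_nonneg_left (hK d) (hexp d)
    _ = _ := by
        simp only [closedWalkCount_eq_sum, expect_sum, Finset.sum_mul]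

lemma varOf_closedWalkCount_le (hp : ∀ i j, 0 ≤ p i j) :
    varOf N p (fun ω => (closedWalkCount N (n + 1) ω : ℝ)) ≤
      expect N p (fun ω => (closedWalkCount N (n + 1) ω : ℝ)) +
        ∑ q ∈ (Finset.univ : Finset (Fin (n + 1) → Fin N)).offDiag,
          covOf N p (cwInd N (n + 1) q.1) (cwInd N (n + 1) q.2) := by
  simp only [varOf_eq, closedWalkCount_eq_sum, covOf_sum_sum, expect_sum]
  rw [← Finset.sum_product', ← Finset.diag_union_offDiag,
    Finset.sum_union (Finset.disjoint_diag_offDiag _), Finset.sum_diag]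
  gcongr with c
  exact covOf_cwInd_self_le hp c

end Expectation

lemma pow_mul_exp_bound {l r w : ℝ} (hr : 0 < r) (hrl : 2 * r < l) (hw : 0 ≤ w) (m : ℕ)
    (hm : (m : ℝ) = r) :
    (l + 2 * r * w / (l - 2 * r)) ^ m + (2 * r) ^ m - l ^ m ≤
      l ^ m * (Real.exp ((2 * r / l) ^ 2 * w / (1 - 2 * r / l)) - 1 + (2 * r / l) ^ m) := by
  have hl : 0 < l := by linarith
  have hlr : 0 < l - 2 * r := by linarith
  set d := 2 * r * w / (l * (l - 2 * r)) with hd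
  have hd0 : 0 ≤ d := by positivity
  have h1 : l + 2 * r * w / (l - 2 * r) = l * (d + 1) := by rw [hd]; field_simp; ring
  have h2 : (2 * r / l) ^ 2 * w / (1 - 2 * r / l) = 2 * (r * d) := by
    have : 1 - 2 * r / l = (l - 2 * r) / l := by field_simp
    rw [hd, this]; field_simp
  have h3 : (d + 1) ^ m ≤ Real.exp (2 * (r * d)) := by
    calc (d + 1) ^ m ≤ Real.exp d ^ m := by gcongr; exact Real.add_one_le_exp d
      _ = Real.exp (r * d) := by rw [← Real.exp_nat_mul, hm]
      _ ≤ _ := Real.exp_le_exp.2 (by nlinarith [mul_nonneg hr.le hd0])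
  have h4 : (2 * r) ^ m = l ^ m * (2 * r / l) ^ m := by rw [← mul_pow]; congr 1; field_simp
  rw [h1, h2, h4, mul_pow]
  nlinarith [mul_le_mul_of_nonneg_left h3 (pow_pos hl m).le]

/-- In the directed Chung-Lu model with `2r < a·b/S`, the sum over pairs of distinct closed-walk
tuples of the covariances of their indicators, and hence the variance of `trace(A^r)`, is
controlled by `E[trace(A^r)] (a·b/S)^r [exp((2rS/(a·b))² p_max/(1-2rS/(a·b))) - 1 + (2rS/(a·b))^r]`. -/
theorem trace_cov_var_upper_bound
    (N : ℕ) (a b : Fin N → ℝ) (ha : ∀ i, 0 ≤ a i) (hb : ∀ i, 0 ≤ b i)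
    (S : ℝ) (hS : 0 < S) (hSa : ∑ i, a i = S) (hSb : ∑ i, b i = S)
    (hmax : ∀ i j, a i * b j ≤ S)
    (pmax : ℝ) (hpmax : IsGreatest {x : ℝ | ∃ i j, x = b i * a j / S} pmax)
    (r : ℕ) (hr : 1 ≤ r) (hrd : 2 * (r : ℝ) < (∑ i, a i * b i) / S) :
    (∑ q ∈ (Finset.univ : Finset (Fin r → Fin N)).offDiag,
        covOf N (fun i j => b i * a j / S) (cwInd N r q.1) (cwInd N r q.2)) ≤
      expect N (fun i j => b i * a j / S) (fun ω => (closedWalkCount N r ω : ℝ)) *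
        ((∑ i, a i * b i) / S) ^ r *
        (Real.exp ((2 * (r : ℝ) * S / (∑ i, a i * b i)) ^ 2 * pmax /
            (1 - 2 * (r : ℝ) * S / (∑ i, a i * b i))) - 1 +
          (2 * (r : ℝ) * S / (∑ i, a i * b i)) ^ r) ∧
    varOf N (fun i j => b i * a j / S) (fun ω => (closedWalkCount N r ω : ℝ)) ≤
      expect N (fun i j => b i * a j / S) (fun ω => (closedWalkCount N r ω : ℝ)) +
      expect N (fun i j => b i * a j / S) (fun ω => (closedWalkCount N r ω : ℝ)) *
        ((∑ i, a i * b i) / S) ^ r *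
        (Real.exp ((2 * (r : ℝ) * S / (∑ i, a i * b i)) ^ 2 * pmax /
            (1 - 2 * (r : ℝ) * S / (∑ i, a i * b i))) - 1 +
          (2 * (r : ℝ) * S / (∑ i, a i * b i)) ^ r) := by
  obtain ⟨n, rfl⟩ : ∃ n, r = n + 1 := ⟨r - 1, by omega⟩
  obtain ⟨⟨i, j, hij⟩, hub⟩ := hpmax
  have : Nonempty (Fin N) := ⟨i⟩
  obtain ⟨i₁, -, hA⟩ := Finset.exists_max_image Finset.univ a Finset.univ_nonempty
  obtain ⟨j₁, -, hB⟩ := Finset.exists_max_image Finset.univ b Finset.univ_nonempty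
  have hpeq : pmax = b j₁ * a i₁ / S := by
    refine le_antisymm ?_ (hub ⟨j₁, i₁, rfl⟩)
    rw [hij]
    gcongr
    exacts [ha j, hb j₁, hB i (Finset.mem_univ _), hA j (Finset.mem_univ _)]
  have hp0 : 0 ≤ pmax := hpeq ▸ div_nonneg (mul_nonneg (hb _) (ha _)) hS.le
  have hp1 : pmax ≤ 1 := by
    rw [hpeq, div_le_one hS, mul_comm]
    exact hmax _ _
  have hp : ∀ i j, 0 ≤ b i * a j / S := fun i j => div_nonneg (mul_nonneg (hb i) (ha j)) hS.le
  set l := (∑ i, a i * b i) / S with hl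
  have hx : 2 * ((n + 1 : ℕ) : ℝ) * S / (∑ i, a i * b i) = 2 * ((n + 1 : ℕ) : ℝ) / l := by
    rw [hl, div_div_eq_mul_div]
  rw [hx]
  have hr1 : (1 : ℝ) ≤ ((n + 1 : ℕ) : ℝ) := by exact_mod_cast hr
  have hK : ∀ d : Fin (n + 1) → Fin N, ∑ c : Fin (n + 1) → Fin N with
      ∃ k, walkEdge c k ∈ walkEdges d, ∏ e ∈ walkEdges c \ walkEdges d, b e.1 * a e.2 / S ≤
      l ^ (n + 1) * (Real.exp ((2 * ((n + 1 : ℕ) : ℝ) / l) ^ 2 * pmax /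
        (1 - 2 * ((n + 1 : ℕ) : ℝ) / l)) - 1 + (2 * ((n + 1 : ℕ) : ℝ) / l) ^ (n + 1)) := by
    intro d
    have h1 := sum_prod_sdiff_walkEdges_le (walkEdges d) ha hb hS
      (fun i => hA i (Finset.mem_univ i)) (fun i => hB i (Finset.mem_univ i))
      (by simpa [walkEdges] using Finset.card_image_le (s := Finset.univ) (f := walkEdge d))
    have h2 := trace_pow_le_of_bool (freshMatrix a b S (a i₁) (b j₁) ((n + 1 : ℕ) : ℝ))
      (s := 2 * ((n + 1 : ℕ) : ℝ)) (w := pmax) (by positivity) hrd rfl rfl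
      (by simp only [freshMatrix, hpeq]; ring) hp0 (by linarith) (n + 1)
    have h3 := pow_mul_exp_bound (by linarith) hrd hp0 (n + 1) rfl
    linarith
  have hcov := sum_covOf_offDiag_le (p := fun i j => b i * a j / S) hp hK
  rw [← mul_assoc] at hcov
  exact ⟨hcov, (varOf_closedWalkCount_le hp).trans (by gcongr)⟩
end
end

section
/- In the directed Chung-Lu model, for every integer r ≥ 1 the expected number of present simple cycles of length r (counted with cyclic rotations) satisfies E[SC_r] ≥ (a·b/S)^r − C(r,2)·p_max·(a·b/S)^{r−1}, where C(r,2) = r(r−1)/2 is the binomial coefficient. -/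
open Finset

noncomputable section
open scoped Classical

/-- Number of present simple cycles of length `r`, counted with their cyclic rotations:
tuples `(i₁, …, i_r, i₁)` with `i₁, …, i_r` pairwise distinct, all of whose `r` edges are
present in `ω`. -/
def simpleCycleCount (N r : ℕ) (ω : Fin N → Fin N → Bool) : ℕ :=
  (Finset.univ.filter (fun c : Fin r → Fin N =>
      Function.Injective c ∧ ∀ k : Fin r, ω (c k) (c (finRotate r k)) = true)).card

theorem sum_prod_eval_eq_prod_sum {ι κ : Type*} [Fintype ι] [DecidableEq ι] [Fintype κ]
    (f : ι → κ → ℝ) : ∑ x : ι → κ, ∏ i, f i (x i) = ∏ i, ∑ k, f i k := by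
  rw [Finset.prod_univ_sum, Fintype.piFinset_univ]

/-- The probability that all edges of `A` are present. -/
theorem expect_indicator_edges (N : ℕ) (p : Fin N → Fin N → ℝ) (A : Finset (Fin N × Fin N)) :
    expect N p (fun ω => if ∀ e ∈ A, ω e.1 e.2 = true then 1 else 0) =
      ∏ e ∈ A, p e.1 e.2 := by
  have indicator_eq_prod (ω : Fin N → Fin N → Bool) :
      (if ∀ e ∈ A, ω e.1 e.2 = true then (1 : ℝ) else 0) =
        ∏ i, ∏ j, if (i, j) ∈ A then (if ω i j then 1 else 0) else 1 := by
    rw [← Fintype.prod_prod_type'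
        (f := fun i j => if (i, j) ∈ A then (if ω i j then (1 : ℝ) else 0) else 1),
      Finset.prod_ite_mem, Finset.univ_inter, Finset.prod_ite_zero, Finset.prod_const_one]
    congr
  unfold _root_.expect configProb
  simp_rw [indicator_eq_prod, ← Finset.prod_mul_distrib]
  rw [sum_prod_eval_eq_prod_sum (fun i (v : Fin N → Bool) =>
    ∏ j, (if v j then p i j else 1 - p i j) *
      if (i, j) ∈ A then (if v j then 1 else 0) else 1)]
  have row (i : Fin N) := sum_prod_eval_eq_prod_sum (fun j (v : Bool) =>
    (if v then p i j else 1 - p i j) * if (i, j) ∈ A then (if v then 1 else 0) else 1)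
  simp_rw [row]
  rw [← Fintype.prod_prod_type' (f := fun i j => ∑ v : Bool,
    (if v then p i j else 1 - p i j) * if (i, j) ∈ A then (if v then 1 else 0) else 1)]
  rw [← Finset.univ_inter A, ← Finset.prod_ite_mem]
  refine Finset.prod_congr rfl fun e _ => ?_
  by_cases h : e ∈ A <;> simp [h]

/-- The expected number of simple cycles as a sum over injective tuples. -/
theorem expect_simpleCycleCount (N r : ℕ) (p : Fin N → Fin N → ℝ) :
    expect N p (fun ω => (simpleCycleCount N r ω : ℝ)) =
      ∑ c : Fin r → Fin N,
        if Function.Injective c then ∏ k, p (c k) (c (finRotate r k)) else 0 := by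
  have count (ω : Fin N → Fin N → Bool) : (simpleCycleCount N r ω : ℝ) =
      ∑ c : Fin r → Fin N, if Function.Injective c ∧
        ∀ k : Fin r, ω (c k) (c (finRotate r k)) = true then 1 else 0 := by
    simp [simpleCycleCount]
  unfold _root_.expect
  simp_rw [count, Finset.mul_sum]
  rw [Finset.sum_comm]
  refine Finset.sum_congr rfl fun c _ => ?_
  by_cases hc : Function.Injective c
  · have edge_inj : Function.Injective fun k => (c k, c (finRotate r k)) :=
      fun k l h => hc (congrArg Prod.fst h)
    have h := expect_indicator_edges N p (Finset.univ.image fun k => (c k, c (finRotate r k)))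
    rw [Finset.prod_image edge_inj.injOn] at h
    simpa [hc, _root_.expect] using h
  · simp [hc]

/-- Dropping the non-injective tuples from the expansion of `(∑ i, x i) ^ r` costs at most
`r.choose 2 * m * (∑ i, x i) ^ (r - 1)` when `x` is bounded by `m`. -/
theorem sum_injective_prod_lower_bound {ι : Type*} [Fintype ι] (x : ι → ℝ) (m : ℝ)
    (hx : ∀ i, 0 ≤ x i) (hm : ∀ i, x i ≤ m) (hm0 : 0 ≤ m) (r : ℕ) :
    (∑ i, x i) ^ r - (r.choose 2 : ℝ) * m * (∑ i, x i) ^ (r - 1) ≤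
      ∑ c : Fin r → ι, if Function.Injective c then ∏ k, x (c k) else 0 := by
  set T := ∑ i, x i with hT
  have hT0 : 0 ≤ T := Finset.sum_nonneg fun i _ => hx i
  induction r with
  | zero => simp [Function.injective_of_subsingleton]
  | succ r ih =>
    set F := ∑ c : Fin r → ι, if Function.Injective c then ∏ k, x (c k) else 0 with hF
    have F_le : F ≤ T ^ r := by
      rw [hT, Fintype.sum_pow]
      refine Finset.sum_le_sum fun c _ => ?_
      split_ifs
      · exact le_rfl
      · exact Finset.prod_nonneg fun k _ => hx _
    have step : F * (T - r * m) ≤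
        ∑ c : Fin (r + 1) → ι, if Function.Injective c then ∏ k, x (c k) else 0 := by
      rw [← (Fin.consEquiv fun _ => ι).sum_comp, Fintype.sum_prod_type_right, hF,
        Finset.sum_mul]
      refine Finset.sum_le_sum fun c _ => ?_
      by_cases hc : Function.Injective c
      · have range_sum : ∑ i, (if i ∈ Set.range c then x i else 0) ≤ r * m := by
          have hfin : ∑ i, (if i ∈ Set.range c then x i else 0) = ∑ k, x (c k) := by
            rw [← Finset.sum_image (s := Finset.univ) (g := c) (f := x) hc.injOn,
              ← Finset.sum_filter]
            congr 1
            ext i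
            simp
          rw [hfin]
          calc ∑ k, x (c k) ≤ ∑ _k : Fin r, m := Finset.sum_le_sum fun k _ => hm _
            _ = r * m := by simp
        have hprod : 0 ≤ ∏ k, x (c k) := Finset.prod_nonneg fun k _ => hx _
        have extend : ∑ i, (if Function.Injective ((Fin.consEquiv fun _ => ι) (i, c)) then
            ∏ k, x ((Fin.consEquiv fun _ => ι) (i, c) k) else 0) =
            (∏ k, x (c k)) * (T - ∑ i, (if i ∈ Set.range c then x i else 0)) := by
          rw [hT, ← Finset.sum_sub_distrib, Finset.mul_sum]
          refine Finset.sum_congr rfl fun i _ => ?_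
          by_cases hi : i ∈ Set.range c
          · simp [Fin.consEquiv, Fin.cons_injective_iff, hi, -Set.mem_range]
          · simp [Fin.consEquiv, Fin.cons_injective_iff, hi, hc, Fin.prod_univ_succ, mul_comm,
              -Set.mem_range]
        rw [extend, if_pos hc]
        gcongr
      · simp [hc, Fin.consEquiv, Fin.cons_injective_iff]
    refine le_trans ?_ step
    have hpow : (r.choose 2 : ℝ) * m * T ^ (r - 1) * T = (r.choose 2 : ℝ) * m * T ^ r := by
      cases r with
      | zero => simp
      | succ n => simp [pow_succ, mul_assoc]
    have hchoose : ((r + 1).choose 2 : ℝ) = r + r.choose 2 := by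
      rw [Nat.choose_succ_succ' r 1]
      simp
    have h1 := mul_le_mul_of_nonneg_right ih hT0
    have h2 := mul_le_mul_of_nonneg_left F_le (mul_nonneg (Nat.cast_nonneg (α := ℝ) r) hm0)
    rw [sub_mul, hpow] at h1
    rw [hchoose, Nat.add_sub_cancel, pow_succ]
    linarith

/-- In the directed Chung-Lu model,
`E[SC_r] ≥ (a·b/S)^r - C(r,2) p_max (a·b/S)^(r-1)`. -/
theorem expected_simple_cycles_lower_bound
    (N : ℕ) (a b : Fin N → ℝ) (ha : ∀ i, 0 ≤ a i) (hb : ∀ i, 0 ≤ b i)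
    (S : ℝ) (hS : 0 < S) (hSa : ∑ i, a i = S) (hSb : ∑ i, b i = S)
    (hmax : ∀ i j, a i * b j ≤ S)
    (pmax : ℝ) (hpmax : IsGreatest {x : ℝ | ∃ i j, x = b i * a j / S} pmax)
    (r : ℕ) (hr : 1 ≤ r) :
    ((∑ i, a i * b i) / S) ^ r -
        (r.choose 2 : ℝ) * pmax * ((∑ i, a i * b i) / S) ^ (r - 1) ≤
      expect N (fun i j => b i * a j / S) (fun ω => (simpleCycleCount N r ω : ℝ)) := by
  have hprod (c : Fin r → Fin N) : ∏ k, b (c k) * a (c (finRotate r k)) / S =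
      ∏ k, a (c k) * b (c k) / S := by
    have hrot : ∏ k, a (c (finRotate r k)) = ∏ k, a (c k) :=
      Equiv.prod_comp (finRotate r) fun k => a (c k)
    simp_rw [Finset.prod_div_distrib, Finset.prod_mul_distrib]
    rw [hrot, mul_comm]
  rw [expect_simpleCycleCount]
  simp_rw [hprod]
  rw [Finset.sum_div]
  convert sum_injective_prod_lower_bound (fun i => a i * b i / S) pmax
    (fun i => div_nonneg (mul_nonneg (ha i) (hb i)) hS.le)
    (fun i => hpmax.2 ⟨i, i, by rw [mul_comm]⟩) ?_ r using 4
  obtain ⟨i, j, rfl⟩ := hpmax.1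
  exact div_nonneg (mul_nonneg (hb i) (ha j)) hS.le
end
end

section
/- Consider a directed graph in which every walk of length less than l* has at most one cycle-inducing edge. Then for any walk in the graph with exactly t cycle-inducing edges, the number of simple directed cycles of length less than l*/2, distinct up to cyclic permutation, that can be formed using edges of the walk's minimal edge list is at most t. -/
open Finset

noncomputable section
open scoped Classical

/-- The minimal edge list of a walk: its distinct edges, in order of first traversal. -/
def minEdgeList {V : Type*} [DecidableEq V] (w : List V) : List (V × V) :=
  ((w.zip w.tail).reverse.dedup).reverse

/-- The `m`-th edge of the edge list `E` is cycle inducing if a simple directed cycle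
containing the `m`-th edge can be formed using only the first `m+1` edges `E_0, …, E_m`. -/
def IsCycleInducing {V : Type*} (E : List (V × V)) (m : Fin E.length) : Prop :=
  ∃ c : List V, c ≠ [] ∧ c.Nodup ∧
    (∀ k : Fin c.length, (c.get k, c.get (finRotate c.length k)) ∈ E.take (m.val + 1)) ∧
    (∃ k : Fin c.length, (c.get k, c.get (finRotate c.length k)) = E.get m)

/-- The number of cycle-inducing edges of the walk `w`. -/
def numCycleInducing {V : Type*} [DecidableEq V] (w : List V) : ℕ :=
  (Finset.univ.filter (fun m : Fin (minEdgeList w).length =>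
      IsCycleInducing (minEdgeList w) m)).card

/-- `c` (a nonempty duplicate-free list of vertices, read cyclically) is a simple directed
cycle all of whose edges belong to the edge list `E`. -/
def IsSimpleCycleOn {V : Type*} (E : List (V × V)) (c : List V) : Prop :=
  c ≠ [] ∧ c.Nodup ∧ ∀ k : Fin c.length, (c.get k, c.get (finRotate c.length k)) ∈ E

/-- The list of edges of the closed walk obtained by reading `c` cyclically. -/
def cycleEdges {V : Type*} (c : List V) : List (V × V) := c.zip (c.rotate 1)

theorem mem_cycleEdges {V : Type*} {c : List V} {e : V × V} :
    e ∈ cycleEdges c ↔ ∃ k : Fin c.length, (c.get k, c.get (finRotate c.length k)) = e := by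
  have hrot : ∀ k : Fin c.length, (finRotate c.length k : ℕ) = (k + 1) % c.length := by
    intro k
    obtain ⟨n, hn⟩ : ∃ n, c.length = n + 1 := ⟨c.length - 1, by have := k.2; omega⟩
    generalize c.length = m at k hn
    subst hn
    rw [finRotate_apply, Fin.val_add]
    simp
  simp only [cycleEdges, List.mem_iff_getElem, List.getElem_zip, List.getElem_rotate,
    List.length_zip, List.length_rotate, min_self, List.get_eq_getElem, hrot]
  constructor
  · rintro ⟨i, hi, h⟩
    exact ⟨⟨i, hi⟩, h⟩
  · rintro ⟨k, h⟩
    exact ⟨k, k.2, h⟩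

theorem mem_cycleEdges_iff_getElem {V : Type*} {l : List V} {e : V × V} :
    e ∈ cycleEdges l ↔ ∃ (i : ℕ) (hi : i < l.length),
      e = (l[i], l[(i + 1) % l.length]'(Nat.mod_lt _ (by omega))) := by
  simp only [cycleEdges, List.mem_iff_getElem, List.getElem_zip, List.getElem_rotate,
    List.length_zip, List.length_rotate, min_self, eq_comm]

theorem isSimpleCycleOn_iff {V : Type*} {L : List (V × V)} {c : List V} :
    IsSimpleCycleOn L c ↔ c ≠ [] ∧ c.Nodup ∧ cycleEdges c ⊆ L := by
  simp only [IsSimpleCycleOn, List.subset_def, mem_cycleEdges, forall_exists_index,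
    forall_apply_eq_imp_iff]

theorem isCycleInducing_iff {V : Type*} {L : List (V × V)} {m : Fin L.length} :
    IsCycleInducing L m ↔ ∃ c : List V, c ≠ [] ∧ c.Nodup ∧
      cycleEdges c ⊆ L.take (m.val + 1) ∧ L.get m ∈ cycleEdges c := by
  simp only [IsCycleInducing, List.subset_def, mem_cycleEdges, forall_exists_index,
    forall_apply_eq_imp_iff]

theorem cycleEdges_cons {V : Type*} (v : V) (p : List V) :
    cycleEdges (v :: p) = (v :: p).zip (p ++ [v]) := by
  simp [cycleEdges]

theorem cycleEdges_rotate {V : Type*} (c : List V) (n : ℕ) :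
    cycleEdges (c.rotate n) = (cycleEdges c).rotate n := by
  simp only [cycleEdges, List.zip]
  rw [List.zipWith_rotate_distrib _ _ _ _ (by simp), List.rotate_rotate, List.rotate_rotate,
    add_comm]

theorem mem_cycleEdges_rotate {V : Type*} {c : List V} {n : ℕ} {e : V × V} :
    e ∈ cycleEdges (c.rotate n) ↔ e ∈ cycleEdges c := by
  rw [cycleEdges_rotate, List.mem_rotate]

theorem fst_mem_of_mem_cycleEdges {V : Type*} {c : List V} {e : V × V}
    (he : e ∈ cycleEdges c) : e.1 ∈ c :=
  (List.of_mem_zip (a := e.1) (b := e.2) he).1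

theorem cycleEdges_ne_nil {V : Type*} {c : List V} (hc : c ≠ []) : cycleEdges c ≠ [] := by
  cases c with
  | nil => exact absurd rfl hc
  | cons v p => simp [cycleEdges_cons]

/-- Two simple cycles with a common starting vertex coincide as soon as the edges of one are
edges of the other. -/
theorem cons_eq_of_cycleEdges_subset {V : Type*} {v : V} {p q : List V}
    (hp : (v :: p).Nodup) (hq : (v :: q).Nodup)
    (h : cycleEdges (v :: q) ⊆ cycleEdges (v :: p)) : v :: q = v :: p := by
  have hpos₁ : 0 < (v :: p).length := by simp
  have hpos₂ : 0 < (v :: q).length := by simp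
  have h₀ : (v :: q)[0] = (v :: p)[0] := rfl
  generalize v :: p = c₁ at *
  generalize v :: q = c₂ at *
  have key : ∀ i : ℕ, c₂[i % c₂.length]'(Nat.mod_lt _ hpos₂) =
      c₁[i % c₁.length]'(Nat.mod_lt _ hpos₁) := by
    intro i
    induction i with
    | zero => simpa using h₀
    | succ i ih =>
      obtain ⟨j, hj, he⟩ := mem_cycleEdges_iff_getElem.1
        (h (mem_cycleEdges_iff_getElem.2 ⟨i % c₂.length, Nat.mod_lt _ hpos₂, rfl⟩))
      obtain ⟨he₁, he₂⟩ := Prod.mk.inj he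
      have hij : i % c₁.length = j := (hp.getElem_inj_iff).1 (ih.symm.trans he₁)
      subst hij
      simpa [Nat.add_mod] using he₂
  have hlen : c₂.length = c₁.length := by
    rcases lt_trichotomy c₂.length c₁.length with hlt | heq | hgt
    · have := key c₂.length
      simp only [Nat.mod_self, Nat.mod_eq_of_lt hlt, h₀] at this
      have := (hp.getElem_inj_iff).1 this
      omega
    · exact heq
    · have := key c₁.length
      simp only [Nat.mod_self, Nat.mod_eq_of_lt hgt, ← h₀] at this
      have := (hq.getElem_inj_iff).1 this
      omega
  refine List.ext_getElem hlen fun i hi₂ hi₁ => ?_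
  simpa only [Nat.mod_eq_of_lt hi₁, Nat.mod_eq_of_lt hi₂] using key i

theorem isChain_iff_forall_mem_zip_tail {V : Type*} {E : V → V → Prop} {w : List V} :
    w.IsChain E ↔ ∀ e ∈ w.zip w.tail, E e.1 e.2 := by
  induction w with
  | nil => simp
  | cons a w ih =>
    cases w with
    | nil => simp
    | cons b w => simpa [List.isChain_cons_cons] using fun _ => ih

theorem mem_minEdgeList {V : Type*} [DecidableEq V] {w : List V} {e : V × V} :
    e ∈ minEdgeList w ↔ e ∈ w.zip w.tail := by
  simp [minEdgeList]

theorem nodup_minEdgeList {V : Type*} [DecidableEq V] (w : List V) : (minEdgeList w).Nodup := by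
  simpa [minEdgeList] using List.nodup_dedup _

/-- If the edge sequence of `w` begins with `A`, then the edges in `A` come first in the minimal
edge list of `w`. -/
theorem exists_minEdgeList_eq_append {V : Type*} [DecidableEq V] {w : List V}
    {A B : List (V × V)} (h : w.zip w.tail = A ++ B) :
    ∃ A' R : List (V × V), minEdgeList w = A' ++ R ∧ ∀ e, e ∈ A' ↔ e ∈ A := by
  obtain ⟨R, hR⟩ := List.suffix_union_right B.reverse A.reverse.dedup
  refine ⟨A.reverse.dedup.reverse, R.reverse, ?_, by simp⟩
  rw [minEdgeList, h, List.reverse_append, List.dedup_append, ← hR, List.reverse_append]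

/-- The last edge, in the order of `L`, of a simple cycle on `L` is cycle inducing. -/
theorem exists_isCycleInducing {V : Type*} {L : List (V × V)} {c : List V}
    (hc : IsSimpleCycleOn L c) :
    ∃ m : Fin L.length, IsCycleInducing L m ∧ L.get m ∈ cycleEdges c ∧
      cycleEdges c ⊆ L.take (m.val + 1) := by
  obtain ⟨hne, hnd, hsub⟩ := isSimpleCycleOn_iff.1 hc
  let S : Finset (Fin L.length) := Finset.univ.filter fun m => L.get m ∈ cycleEdges c
  have hS : S.Nonempty := by
    obtain ⟨e, he⟩ := List.exists_mem_of_ne_nil _ (cycleEdges_ne_nil hne)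
    obtain ⟨m, rfl⟩ := List.get_of_mem (hsub he)
    exact ⟨m, by simpa [S] using he⟩
  have hmem : L.get (S.max' hS) ∈ cycleEdges c := (Finset.mem_filter.1 (S.max'_mem hS)).2
  have htake : cycleEdges c ⊆ L.take ((S.max' hS).val + 1) := by
    intro e he
    obtain ⟨m, rfl⟩ := List.get_of_mem (hsub he)
    have hle : m ≤ S.max' hS := S.le_max' m (by simpa [S] using he)
    exact List.mem_take_iff_getElem.2 ⟨m, by have := m.2; have : m.val ≤ _ := hle; omega, rfl⟩
  exact ⟨_, isCycleInducing_iff.2 ⟨c, hne, hnd, htake, hmem⟩, hmem, htake⟩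

theorem zip_tail_two_cycles {V : Type*} (v : V) (p q : List V) :
    ((v :: p) ++ (v :: q) ++ [v]).zip ((v :: p) ++ (v :: q) ++ [v]).tail =
      cycleEdges (v :: p) ++ cycleEdges (v :: q) := by
  have : ((v :: p) ++ (v :: q) ++ [v]).tail = (p ++ [v]) ++ ((q ++ [v]) ++ []) := by simp
  rw [this, List.append_assoc, List.zip_append (by simp), List.zip_append (by simp),
    ← cycleEdges_cons, ← cycleEdges_cons]
  simp

/-- Traversing one simple cycle and then another one through the same vertex yields at least two
cycle-inducing edges. -/
theorem two_le_numCycleInducing {V : Type*} [DecidableEq V] {v : V} {p q : List V}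
    (hp : (v :: p).Nodup) (hq : (v :: q).Nodup) (hne : v :: q ≠ v :: p) :
    2 ≤ numCycleInducing ((v :: p) ++ (v :: q) ++ [v]) := by
  set w := (v :: p) ++ (v :: q) ++ [v]
  have hzip : w.zip w.tail = cycleEdges (v :: p) ++ cycleEdges (v :: q) :=
    zip_tail_two_cycles v p q
  obtain ⟨A, R, hL, hA⟩ := exists_minEdgeList_eq_append hzip
  have hnd := nodup_minEdgeList w
  have hcyc : ∀ c : List V, c ≠ [] → c.Nodup →
      cycleEdges c ⊆ cycleEdges (v :: p) ++ cycleEdges (v :: q) →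
      IsSimpleCycleOn (minEdgeList w) c := fun c h₁ h₂ h₃ =>
    isSimpleCycleOn_iff.2 ⟨h₁, h₂, fun e he => mem_minEdgeList.2 (hzip ▸ h₃ he)⟩
  obtain ⟨m₁, hm₁, hmem₁, -⟩ := exists_isCycleInducing
    (hcyc (v :: p) (by simp) hp (List.subset_append_left _ _))
  obtain ⟨m₂, hm₂, -, htake⟩ := exists_isCycleInducing
    (hcyc (v :: q) (by simp) hq (List.subset_append_right _ _))
  have hm_ne : m₁ ≠ m₂ := by
    rintro rfl
    refine hne (cons_eq_of_cycleEdges_subset hp hq fun e he => (hA e).1 ?_)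
    have hlt : m₁.val < A.length := by
      obtain ⟨j, hj, hj'⟩ := List.getElem_of_mem ((hA _).2 hmem₁)
      have hj₂ : (minEdgeList w)[j]'(by rw [hL, List.length_append]; omega) =
          (minEdgeList w)[m₁.val] := by
        rw [← List.get_eq_getElem (i := m₁), ← hj']
        simp only [hL, List.getElem_append_left hj]
      exact (hnd.getElem_inj_iff).1 hj₂ ▸ hj
    have htakeA : (minEdgeList w).take (m₁.val + 1) = A.take (m₁.val + 1) := by
      simp only [hL, List.take_append_of_le_length (Nat.succ_le_of_lt hlt)]
    exact List.mem_of_mem_take (htakeA ▸ htake he)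
  calc 2 = ({m₁, m₂} : Finset _).card := (Finset.card_pair hm_ne).symm
    _ ≤ _ := Finset.card_le_card (by
      intro m hm
      rcases Finset.mem_insert.1 hm with rfl | hm
      · simpa using hm₁
      · rw [Finset.mem_singleton.1 hm]; simpa using hm₂)

/-- Under the sparsity hypothesis, two short simple cycles sharing a vertex agree up to
rotation. -/
theorem isRotated_of_common_vertex {V : Type*} [DecidableEq V] {E : V → V → Prop} {lstar : ℝ}
    (hG : ∀ w : List V, w.IsChain E → (w.length : ℝ) - 1 < lstar → numCycleInducing w ≤ 1)
    {c₁ c₂ : List V} (hnd₁ : c₁.Nodup) (hnd₂ : c₂.Nodup)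
    (hE₁ : ∀ e ∈ cycleEdges c₁, E e.1 e.2) (hE₂ : ∀ e ∈ cycleEdges c₂, E e.1 e.2)
    (hlen₁ : (c₁.length : ℝ) < lstar / 2) (hlen₂ : (c₂.length : ℝ) < lstar / 2)
    {v : V} (hv₁ : v ∈ c₁) (hv₂ : v ∈ c₂) : c₁.IsRotated c₂ := by
  have hrot : ∀ c : List V, v ∈ c → ∃ p n, c.rotate n = v :: p := by
    intro c hv
    obtain ⟨s, t, rfl⟩ := List.append_of_mem hv
    exact ⟨t ++ s, s.length, by simp [List.rotate_append_length_eq]⟩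
  obtain ⟨p, n₁, hp⟩ := hrot c₁ hv₁
  obtain ⟨q, n₂, hq⟩ := hrot c₂ hv₂
  by_contra hcon
  have hne : v :: q ≠ v :: p := by
    intro h
    have hr₁ : c₁.IsRotated (v :: p) := ⟨n₁, hp⟩
    have hr₂ : c₂.IsRotated (v :: p) := ⟨n₂, hq.trans h⟩
    exact hcon (hr₁.trans hr₂.symm)
  have htwo := two_le_numCycleInducing (v := v) (p := p) (q := q)
    (hp ▸ List.nodup_rotate.2 hnd₁) (hq ▸ List.nodup_rotate.2 hnd₂) hne
  have hl₁ : (v :: p).length = c₁.length := by rw [← hp, List.length_rotate]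
  have hl₂ : (v :: q).length = c₂.length := by rw [← hq, List.length_rotate]
  have hone := hG ((v :: p) ++ (v :: q) ++ [v]) ?_ ?_
  · omega
  · rw [isChain_iff_forall_mem_zip_tail, zip_tail_two_cycles, ← hp, ← hq]
    intro e he
    rcases List.mem_append.1 he with he | he
    · exact hE₁ e (mem_cycleEdges_rotate.1 he)
    · exact hE₂ e (mem_cycleEdges_rotate.1 he)
  · rw [List.length_append, List.length_append, hl₁, hl₂]
    push_cast
    simp
    linarith

/-- In a directed graph in which every walk of length less than `l*` has at most one
cycle-inducing edge, from the minimal edge list of any walk with exactly `t` cycle-inducing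
edges one can form at most `t` simple cycles of length less than `l*/2` that are distinct up
to cyclic permutation. -/
theorem cycles_from_walk_bound
    (V : Type*) [Fintype V] [DecidableEq V] (E : V → V → Prop) (lstar : ℝ)
    (hG : ∀ w : List V, w.Chain' E → (w.length : ℝ) - 1 < lstar → numCycleInducing w ≤ 1)
    (w : List V) (hw : w.Chain' E)
    (t : ℕ) (ht : numCycleInducing w = t)
    (C : Finset (List V))
    (hC : ∀ c ∈ C, IsSimpleCycleOn (minEdgeList w) c ∧ (c.length : ℝ) < lstar / 2)
    (hdist : ∀ c₁ ∈ C, ∀ c₂ ∈ C, c₁ ≠ c₂ → ¬ c₁.IsRotated c₂) :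
    C.card ≤ t := by
  have hinE : ∀ c ∈ C, ∀ e ∈ cycleEdges c, E e.1 e.2 := fun c hc e he =>
    isChain_iff_forall_mem_zip_tail.1 hw e
      (mem_minEdgeList.1 ((isSimpleCycleOn_iff.1 (hC c hc).1).2.2 he))
  choose f hf using fun c : C => exists_isCycleInducing (hC c c.2).1
  rw [← ht, numCycleInducing, ← C.card_attach]
  refine Finset.card_le_card_of_injOn f (fun c _ => by simpa using (hf c).1) ?_
  rintro ⟨c₁, h₁⟩ - ⟨c₂, h₂⟩ - heq
  by_contra hne
  refine hdist c₁ h₁ c₂ h₂ (fun h => hne (Subtype.ext h))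
    (isRotated_of_common_vertex hG (hC c₁ h₁).1.2.1 (hC c₂ h₂).1.2.1
      (hinE c₁ h₁) (hinE c₂ h₂) (hC c₁ h₁).2 (hC c₂ h₂).2
      (fst_mem_of_mem_cycleEdges (hf ⟨c₁, h₁⟩).2.1) ?_)
  rw [heq]
  exact fst_mem_of_mem_cycleEdges (hf ⟨c₂, h₂⟩).2.1
end
end
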